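/- arXiv:2512.18936 — 2 statements merged into one kernel-verified Lean document; each statement's English description precedes it below -/
import Mathlib

section
/- (a) The infinite product G_𝔣(s) := ∏_p G_p(s) converges absolutely and locally uniformly on the half-plane Re s > 1/3 and defines a holomorphic function there. (b) For every σ₁ > 1/3, G_𝔣 is uniformly bounded on the half-plane Re s ≥ σ₁, i.e. sup_{Re s ≥ σ₁} |G_𝔣(s)| < ∞. -/
open Asymptotics Filter Topology

/-- Second-order Taylor expansion of `(1 - u) ^ a` at the origin. -/
lemma one_sub_cpow_sub_taylor_isBigO (a : ℂ) :
    (fun u : ℂ ↦ (1 - u) ^ a - (1 - a * u + a * (a - 1) / 2 * u ^ 2)) =O[𝓝 0] fun u ↦ u ^ 3 := by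
  have h := (Complex.one_add_cpow_hasFPowerSeriesAt_zero (a := a)).isBigO_sub_partialSum_pow 3
  have hchoose : Ring.choose a 2 = a * (a - 1) / 2 := by
    have := Ring.descPochhammer_eq_factorial_smul_choose a 2
    simp [descPochhammer_succ_right, Polynomial.smeval_mul, Polynomial.smeval_sub,
      Polynomial.smeval_X] at this
    field_simp
    linear_combination -this
  have hneg : Tendsto (fun u : ℂ ↦ -u) (𝓝 0) (𝓝 0) := by
    simpa using (continuous_neg (G := ℂ)).tendsto 0
  have h' := h.comp_tendsto hneg
  refine (h'.congr_left fun u ↦ ?_).trans (.of_bound 1 (.of_forall fun u ↦ by simp))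
  simp [FormalMultilinearSeries.partialSum, Finset.sum_range_succ, binomialSeries,
    FormalMultilinearSeries.coeff_ofScalars, hchoose, ← sub_eq_add_neg]
  ring

/-- A power series with coefficients bounded by `1` is holomorphic on the unit disc. -/
lemma differentiableOn_tsum_mul_pow {ε : ℕ → ℂ} (hε : ∀ k, ‖ε k‖ ≤ 1) :
    DifferentiableOn ℂ (fun u : ℂ ↦ ∑' k, ε k * u ^ k) (Metric.ball 0 1) := by
  intro u hu
  obtain ⟨ρ, hρ, hρ1⟩ := exists_between (mem_ball_zero_iff.mp hu)
  have hρ0 : 0 ≤ ρ := (norm_nonneg u).trans hρ.le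
  have hd : DifferentiableOn ℂ (fun u : ℂ ↦ ∑' k, ε k * u ^ k) (Metric.ball 0 ρ) := by
    refine Complex.differentiableOn_tsum_of_summable_norm (summable_geometric_of_lt_one hρ0 hρ1)
      (fun k ↦ by fun_prop) Metric.isOpen_ball fun k v hv ↦ ?_
    rw [norm_mul, norm_pow, ← one_mul (ρ ^ k)]
    have := mem_ball_zero_iff.mp hv
    gcongr
    exact hε k
  exact (hd.differentiableAt
    (Metric.isOpen_ball.mem_nhds (by simpa using hρ))).differentiableWithinAt

lemma tsum_mul_pow_sub_taylor_isBigO {ε : ℕ → ℂ} (hε : ∀ k, ‖ε k‖ ≤ 1) :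
    (fun u : ℂ ↦ ∑' k, ε k * u ^ k - (ε 0 + ε 1 * u + ε 2 * u ^ 2)) =O[𝓝 0] fun u ↦ u ^ 3 := by
  have htail : ContinuousAt (fun u : ℂ ↦ ∑' k, ε (k + 3) * u ^ k) 0 :=
    ((differentiableOn_tsum_mul_pow (fun k ↦ hε (k + 3))).differentiableAt
      (Metric.ball_mem_nhds 0 one_pos)).continuousAt
  have hO := (htail.isBigO_one ℂ).mul (isBigO_refl (fun u : ℂ ↦ u ^ 3) (𝓝 0))
  simp only [one_mul] at hO
  refine hO.congr' ?_ .rfl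
  filter_upwards [Metric.ball_mem_nhds (0 : ℂ) one_pos] with u hu
  have hs : Summable fun k ↦ ε k * u ^ k := by
    refine .of_norm_bounded (summable_geometric_of_lt_one (norm_nonneg u)
      (mem_ball_zero_iff.mp hu)) fun k ↦ ?_
    rw [norm_mul, norm_pow]
    exact mul_le_of_le_one_left (by positivity) (hε k)
  rw [← hs.sum_add_tsum_nat_add 3, ← tsum_mul_right]
  simp [Finset.sum_range_succ, pow_add, mul_assoc]

/-- The local factor of the Euler product, as a function of `u = p ^ (-s)`. -/
noncomputable def fakeMuLocalFactor (ε : ℕ → ℂ) (z w u : ℂ) : ℂ :=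
  (1 - u) ^ z * (1 - u ^ 2) ^ w * ∑' k, ε k * u ^ k

lemma differentiableOn_fakeMuLocalFactor {ε : ℕ → ℂ} (hε : ∀ k, ‖ε k‖ ≤ 1) (z w : ℂ) :
    DifferentiableOn ℂ (fakeMuLocalFactor ε z w) (Metric.ball 0 1) := by
  have hslit {v : ℂ} (hv : ‖v‖ < 1) : 1 - v ∈ Complex.slitPlane := by
    simpa [sub_eq_add_neg] using Complex.mem_slitPlane_of_norm_lt_one (z := -v) (by simpa using hv)
  refine .mul (.mul (.cpow_const (by fun_prop) fun u hu ↦ hslit (mem_ball_zero_iff.mp hu))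
    (.cpow_const (by fun_prop) fun u hu ↦ hslit ?_)) (differentiableOn_tsum_mul_pow hε)
  rw [norm_pow]
  exact pow_lt_one₀ (norm_nonneg u) (mem_ball_zero_iff.mp hu) two_ne_zero

/-- The exponents `z = ε 1` and `w = ε 2 - ε 1 * (ε 1 + 1) / 2` cancel the linear and quadratic
terms of the local factor. -/
lemma fakeMuLocalFactor_sub_one_isBigO {ε : ℕ → ℂ} (hε0 : ε 0 = 1) (hε : ∀ k, ‖ε k‖ ≤ 1) :
    (fun u ↦ fakeMuLocalFactor ε (ε 1) (ε 2 - ε 1 * (ε 1 + 1) / 2) u - 1)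
      =O[𝓝 0] fun u ↦ u ^ 3 := by
  generalize hz : ε 1 = z
  generalize hw : ε 2 - z * (z + 1) / 2 = w
  have hA := one_sub_cpow_sub_taylor_isBigO z
  have hsq : Tendsto (fun u : ℂ ↦ u ^ 2) (𝓝 0) (𝓝 0) := by
    simpa using (continuous_pow (M := ℂ) 2).tendsto 0
  have hmul {f g : ℂ → ℂ} (hf : f =O[𝓝 0] fun u ↦ u ^ 3) (hg : ContinuousAt g 0) :
      (fun u ↦ f u * g u) =O[𝓝 0] fun u ↦ u ^ 3 := by
    simpa using hf.mul (hg.isBigO_one ℂ)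
  have hcube : (fun u : ℂ ↦ (u ^ 2) ^ 3) =O[𝓝 0] fun u ↦ u ^ 3 := by
    simp_rw [← pow_mul, Nat.mul_comm 2 3, pow_mul, pow_two]
    exact hmul (isBigO_refl _ _) (by fun_prop)
  have hB := ((one_sub_cpow_sub_taylor_isBigO w).comp_tendsto hsq).trans hcube
  have hG := tsum_mul_pow_sub_taylor_isBigO hε
  have hBc : ContinuousAt (fun u : ℂ ↦ (1 - u ^ 2) ^ w) 0 :=
    ContinuousAt.cpow (by fun_prop) (by fun_prop) (by simp)
  have hGc : ContinuousAt (fun u : ℂ ↦ ∑' k, ε k * u ^ k) 0 :=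
    ((differentiableOn_tsum_mul_pow hε).differentiableAt
      (Metric.ball_mem_nhds 0 one_pos)).continuousAt
  have hq := hmul (g := fun u ↦ u * (w * (w - 1) / 2 - w ^ 2) + u ^ 3 * (w * (w * (w - 1) / 2)) +
    (z * (z - 1) / 2 * z - z * ε 2 + z * (z - 1) / 2 * ε 2 * u) *
      (1 - w * u ^ 2 + w * (w - 1) / 2 * (u ^ 2) ^ 2)) (isBigO_refl _ _) (by fun_prop)
  have h₁ := hmul hA (hBc.mul hGc)
  have h₂ := hmul hB (hGc.mul (g := fun u ↦ 1 - z * u + z * (z - 1) / 2 * u ^ 2) (by fun_prop))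
  have h₃ := hmul hG (g := fun u ↦ (1 - z * u + z * (z - 1) / 2 * u ^ 2) *
    (1 - w * u ^ 2 + w * (w - 1) / 2 * (u ^ 2) ^ 2)) (by fun_prop)
  refine (((h₁.add h₂).add h₃).add hq).congr_left fun u ↦ ?_
  have hε2 : ε 2 = w + z * (z + 1) / 2 := by rw [← hw]; ring
  simp only [fakeMuLocalFactor, Function.comp_apply, Pi.mul_apply, hε0, hz, hε2]
  ring

lemma exists_norm_le_mul_pow_of_isBigO {f : ℂ → ℂ} {r : ℝ} {n : ℕ}
    (hf : ContinuousOn f (Metric.closedBall 0 r)) (hO : f =O[𝓝 0] fun u ↦ u ^ n) :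
    ∃ C, ∀ u, ‖u‖ ≤ r → ‖f u‖ ≤ C * ‖u‖ ^ n := by
  obtain ⟨c, hc⟩ := hO.bound
  obtain ⟨δ, hδ, hball⟩ := Metric.eventually_nhds_iff_ball.mp hc
  obtain ⟨M, hM⟩ := (isCompact_closedBall (0 : ℂ) r).exists_bound_of_continuousOn hf
  refine ⟨max c (M / δ ^ n), fun u hu ↦ ?_⟩
  rcases lt_or_ge ‖u‖ δ with h | h
  · have := hball u (by simpa using h)
    rw [norm_pow] at this
    exact this.trans (by gcongr; exact le_max_left _ _)
  · have h1 := hM u (by simpa using hu)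
    have hM0 := (norm_nonneg _).trans h1
    calc ‖f u‖ ≤ M := h1
      _ = M / δ ^ n * δ ^ n := by field_simp
      _ ≤ M / δ ^ n * ‖u‖ ^ n := by gcongr
      _ ≤ _ := by gcongr; exact le_max_right _ _


/-- (a) The Euler product `G_𝔣(s) = ∏_p G_p(s)` converges absolutely
and locally uniformly on `Re s > 1/3` and defines a holomorphic function there.
(b) For every `σ₁ > 1/3`, `G_𝔣` is uniformly bounded on `Re s ≥ σ₁`. -/
theorem fakeMu_G_holomorphic_and_bounded
    (ε : ℕ → ℂ) (hε0 : ε 0 = 1)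
    (hε : ∀ k, 1 ≤ k → ‖ε k‖ = 1 ∨ ε k = 0)
    (z w : ℂ) (hz : z = ε 1) (hw : w = ε 2 - ε 1 * (ε 1 + 1) / 2)
    (Gp : Nat.Primes → ℂ → ℂ)
    (hGp : ∀ (p : Nat.Primes) (s : ℂ),
      Gp p s = (1 - ((p : ℕ) : ℂ) ^ (-s)) ^ z * (1 - ((p : ℕ) : ℂ) ^ (-(2 * s))) ^ w *
        (∑' k : ℕ, ε k * (((p : ℕ) : ℂ) ^ (-s)) ^ k)) :
    (∀ s : ℂ, 1 / 3 < s.re → Summable (fun p : Nat.Primes => ‖Gp p s - 1‖)) ∧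
    (∀ s : ℂ, 1 / 3 < s.re → Multipliable (fun p : Nat.Primes => Gp p s)) ∧
    TendstoLocallyUniformlyOn
      (fun (N : Finset Nat.Primes) (s : ℂ) => ∏ p ∈ N, Gp p s)
      (fun s : ℂ => ∏' p : Nat.Primes, Gp p s) Filter.atTop {s : ℂ | 1 / 3 < s.re} ∧
    DifferentiableOn ℂ (fun s : ℂ => ∏' p : Nat.Primes, Gp p s) {s : ℂ | 1 / 3 < s.re} ∧
    (∀ σ₁ : ℝ, 1 / 3 < σ₁ → ∃ C : ℝ, ∀ s : ℂ, σ₁ ≤ s.re →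
      ‖∏' p : Nat.Primes, Gp p s‖ ≤ C) := by
  have hε1 (k : ℕ) : ‖ε k‖ ≤ 1 := by
    rcases k.eq_zero_or_pos with rfl | hk
    · simp [hε0]
    · rcases hε k hk with h | h <;> simp [h]
  have hGF (p : Nat.Primes) (s : ℂ) : Gp p s = fakeMuLocalFactor ε z w ((p : ℂ) ^ (-s)) := by
    rw [hGp, fakeMuLocalFactor, ← Complex.cpow_nat_mul]
    congr 3
    push_cast
    ring_nf
  have hnorm (p : Nat.Primes) (s : ℂ) : ‖(p : ℂ) ^ (-s)‖ = (p : ℝ) ^ (-s.re) := by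
    rw [Complex.norm_natCast_cpow_of_pos p.2.pos, Complex.neg_re]
  have hF := differentiableOn_fakeMuLocalFactor hε1 z w
  have hO := fakeMuLocalFactor_sub_one_isBigO hε0 hε1
  rw [← hw, ← hz] at hO
  have hdiff (p : Nat.Primes) : DifferentiableOn ℂ (Gp p) {s : ℂ | 1 / 3 < s.re} := by
    rw [funext (hGF p)]
    have hp : (p : ℂ) ≠ 0 := Nat.cast_ne_zero.mpr p.2.ne_zero
    refine hF.comp (t := Metric.ball 0 1) (fun s _ ↦ ?_) fun s hs ↦ ?_
    · exact (DifferentiableAt.const_cpow (by fun_prop) (.inl hp)).differentiableWithinAt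
    · have hs' : (1 / 3 : ℝ) < s.re := hs
      rw [mem_ball_zero_iff, hnorm]
      exact Real.rpow_lt_one_of_one_lt_of_neg (mod_cast p.2.one_lt) (by linarith)
  have hbound (σ : ℝ) (hσ : 1 / 3 < σ) : ∃ b : Nat.Primes → ℝ, Summable b ∧
      ∀ p (s : ℂ), σ ≤ s.re → ‖Gp p s - 1‖ ≤ b p := by
    have hr : (2 : ℝ) ^ (-σ) < 1 :=
      Real.rpow_lt_one_of_one_lt_of_neg one_lt_two (by linarith)
    obtain ⟨C, hC⟩ := exists_norm_le_mul_pow_of_isBigO (r := 2 ^ (-σ))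
      ((hF.continuousOn.sub continuousOn_const).mono (Metric.closedBall_subset_ball hr)) hO
    refine ⟨fun p ↦ |C| * (p : ℝ) ^ (-(3 * σ)),
      (Nat.Primes.summable_rpow.mpr (by linarith)).mul_left _, fun p s hs ↦ ?_⟩
    have hle : ‖(p : ℂ) ^ (-s)‖ ≤ (p : ℝ) ^ (-σ) := by
      rw [hnorm]
      exact Real.rpow_le_rpow_of_exponent_le (mod_cast p.2.one_le) (by linarith)
    have hle' : (p : ℝ) ^ (-σ) ≤ 2 ^ (-σ) :=
      Real.rpow_le_rpow_of_nonpos two_pos (mod_cast p.2.two_le) (by linarith)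
    rw [hGF]
    calc _ ≤ C * ‖(p : ℂ) ^ (-s)‖ ^ 3 := hC _ (hle.trans hle')
      _ ≤ |C| * ((p : ℝ) ^ (-σ)) ^ 3 := by gcongr; exact le_abs_self C
      _ = |C| * (p : ℝ) ^ (-(3 * σ)) := by
        rw [← Real.rpow_mul_natCast (Nat.cast_nonneg _)]
        congr 2
        push_cast
        ring
  have hsum (s : ℂ) (hs : 1 / 3 < s.re) : Summable fun p ↦ ‖Gp p s - 1‖ := by
    obtain ⟨b, hb, hle⟩ := hbound s.re hs
    exact hb.of_nonneg_of_le (fun _ ↦ norm_nonneg _) fun p ↦ hle p s le_rfl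
  have hmult (s : ℂ) (hs : 1 / 3 < s.re) : Multipliable fun p ↦ Gp p s := by
    simpa using multipliable_one_add_of_summable (hsum s hs)
  have hopen (σ : ℝ) : IsOpen {s : ℂ | σ < s.re} := isOpen_lt continuous_const Complex.continuous_re
  have hunif : TendstoLocallyUniformlyOn (fun (N : Finset Nat.Primes) (s : ℂ) ↦ ∏ p ∈ N, Gp p s)
      (fun s ↦ ∏' p, Gp p s) atTop {s : ℂ | 1 / 3 < s.re} := by
    refine (tendstoLocallyUniformlyOn_iff_forall_isCompact (hopen _)).mpr fun K hK hKc ↦ ?_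
    rcases K.eq_empty_or_nonempty with rfl | hne
    · exact tendstoUniformlyOn_empty
    obtain ⟨s₀, hs₀, hmin⟩ := hKc.exists_isMinOn hne Complex.continuous_re.continuousOn
    obtain ⟨b, hb, hle⟩ := hbound s₀.re (hK hs₀)
    have h := hb.hasProdUniformlyOn_one_add (f := fun p s ↦ Gp p s - 1) hKc
      (.of_forall fun p s hs ↦ hle p s (hmin hs))
      fun p ↦ ((hdiff p).continuousOn.mono hK).sub continuousOn_const
    simpa [hasProdUniformlyOn_iff_tendstoUniformlyOn] using h
  refine ⟨hsum, hmult, hunif, hunif.differentiableOn (.of_forall fun N ↦ ?_) (hopen _),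
    fun σ hσ ↦ ?_⟩
  · exact DifferentiableOn.fun_finsetProd fun p _ ↦ hdiff p
  · obtain ⟨b, hb, hle⟩ := hbound σ hσ
    refine ⟨Real.exp (∑' p, b p), fun s hs ↦
      le_of_tendsto (hmult s (hσ.trans_le hs)).hasProd.norm (.of_forall fun N ↦ ?_)⟩
    have hb0 (p : Nat.Primes) : 0 ≤ b p := (norm_nonneg _).trans (hle p s hs)
    calc ∏ p ∈ N, ‖Gp p s‖ ≤ ∏ p ∈ N, Real.exp (b p) := by
          refine Finset.prod_le_prod (fun _ _ ↦ norm_nonneg _) fun p _ ↦ ?_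
          calc ‖Gp p s‖ ≤ ‖Gp p s - 1‖ + 1 := by
                simpa using norm_add_le (Gp p s - 1) 1
            _ ≤ b p + 1 := by gcongr; exact hle p s hs
            _ ≤ _ := Real.add_one_le_exp _
      _ = Real.exp (∑ p ∈ N, b p) := (Real.exp_sum _ _).symm
      _ ≤ _ := Real.exp_le_exp.mpr (hb.sum_le_tsum N fun p _ ↦ hb0 p)
end

section
/- Assume −1 < Re z < 1 and Re w < 1. For 0 < u < 1/2 one has ζ(1−u) < 0, hence (−u)ζ(1−u) > 0 and ζ(2−2u) > 0; define J₁(u) := ((−u)ζ(1−u))^z · ζ(2−2u)^w · G_𝔣(1−u) · Γ(1−u) (powers of positive reals via the real logarithm), and for x > 3 define Δ₁(x) := (sin(πz)/π) · x · ∫_0^{1/2} e^{−u·log x} u^{−z} J₁(u) du. Then the integral converges absolutely for every x > 3, and as x → ∞, Δ₁(x) · x^{−1} · (log x)^{1−z} → (sin(πz)/π) · Γ(1−z) · ζ(2)^w · G_𝔣(1), where (log x)^{1−z} := e^{(1−z) log log x}. -/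
open MeasureTheory

open Set Filter Topology Asymptotics in
theorem mellinConvergent_fract_and_differentiableAt (s : ℂ) (hs : 0 < s.re) :
    MellinConvergent (indicator (Ioi 1) fun t : ℝ => ((Int.fract t : ℝ) : ℂ)) (-s) ∧
    DifferentiableAt ℂ (mellin (indicator (Ioi 1) fun t : ℝ => ((Int.fract t : ℝ) : ℂ))) (-s) := by
  have hm : Measurable (indicator (Ioi 1) fun t : ℝ => ((Int.fract t : ℝ) : ℂ)) :=
    (Complex.measurable_ofReal.comp measurable_fract).indicator measurableSet_Ioi
  have hb : ∀ t : ℝ, ‖indicator (Ioi 1) (fun t : ℝ => ((Int.fract t : ℝ) : ℂ)) t‖ ≤ 1 := by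
    intro t
    refine (norm_indicator_le_norm_self _ _).trans ?_
    rw [Complex.norm_real, Real.norm_of_nonneg (Int.fract_nonneg _)]
    exact (Int.fract_lt_one _).le
  have hloc : LocallyIntegrableOn
      (indicator (Ioi 1) fun t : ℝ => ((Int.fract t : ℝ) : ℂ)) (Ioi 0) := by
    refine LocallyIntegrable.locallyIntegrableOn ?_ _
    refine (locallyIntegrable_const (1 : ℝ)).mono hm.aestronglyMeasurable ?_
    exact Eventually.of_forall fun t => by simpa using hb t
  have htop : (indicator (Ioi 1) fun t : ℝ => ((Int.fract t : ℝ) : ℂ))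
      =O[atTop] (fun t : ℝ => t ^ (-(0 : ℝ))) := by
    refine IsBigO.of_bound 1 (Eventually.of_forall fun t => ?_)
    simpa using hb t
  have hbot : (indicator (Ioi 1) fun t : ℝ => ((Int.fract t : ℝ) : ℂ))
      =O[𝓝[>] 0] (fun t : ℝ => t ^ (-(-s.re - 1))) := by
    refine EventuallyEq.trans_isBigO ?_ (isBigO_zero _ _)
    filter_upwards [mem_nhdsWithin_of_mem_nhds (Iio_mem_nhds (zero_lt_one' ℝ))] with t ht
    exact indicator_of_notMem (by simpa using (mem_Iio.mp ht).le) _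
  exact ⟨mellinConvergent_of_isBigO_rpow hloc htop (by simpa using hs) hbot (by simp),
    mellin_differentiableAt_of_isBigO_rpow hloc htop (by simpa using hs) hbot (by simp)⟩

open Set Filter in
theorem mellin_fract_eq (s : ℂ) :
    mellin (indicator (Ioi 1) fun t : ℝ => ((Int.fract t : ℝ) : ℂ)) (-s) =
      ∫ t in Ioi (1 : ℝ), ((Int.fract t : ℝ) : ℂ) * (t : ℂ) ^ (-(s + 1)) := by
  rw [mellin, ← integral_indicator measurableSet_Ioi, ← integral_indicator measurableSet_Ioi]
  congr 1
  ext t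
  by_cases ht : 1 < t
  · simp [indicator, ht, zero_lt_one.trans ht, mul_comm, sub_eq_add_neg, add_comm]
  · simp [indicator, ht]

open Set Filter in
theorem riemannZeta₁_eq_of_one_lt_re {s : ℂ} (hs : 1 < s.re) :
    riemannZeta₁ s = s - s * (s - 1) *
      mellin (indicator (Ioi 1) fun t : ℝ => ((Int.fract t : ℝ) : ℂ)) (-s) := by
  have hs1 : s - 1 ≠ 0 := by
    intro h
    have := congrArg Complex.re h
    simp at this
    linarith
  have hL := LSeries_eq_mul_integral 1 zero_le_one hs (LSeriesSummable_one_iff.mpr hs) (by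
    refine Asymptotics.IsBigO.of_bound 1 (Eventually.of_forall fun n => by simp))
  rw [LSeries_one_eq_riemannZeta hs] at hL
  have hint1 : IntegrableOn (fun t : ℝ => (t : ℂ) ^ (-s)) (Ioi 1) :=
    integrableOn_Ioi_cpow_of_lt (by simpa using hs) one_pos
  have hint2 : IntegrableOn (fun t : ℝ => ((Int.fract t : ℝ) : ℂ) * (t : ℂ) ^ (-(s + 1)))
      (Ioi 1) := by
    refine Integrable.mono (integrableOn_Ioi_cpow_of_lt (a := -(s + 1))
      (by simp; linarith) one_pos) ?_ ?_
    · exact (Complex.measurable_ofReal.comp measurable_fract).aestronglyMeasurable.mul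
        (integrableOn_Ioi_cpow_of_lt (a := -(s + 1)) (by simp; linarith) one_pos).1
    · refine Eventually.of_forall fun t => ?_
      rw [norm_mul, Complex.norm_real, Real.norm_of_nonneg (Int.fract_nonneg _)]
      exact mul_le_of_le_one_left (norm_nonneg _) (Int.fract_lt_one _).le
  have hsplit : ∫ t in Ioi (1 : ℝ), (∑ k ∈ Finset.Icc 1 ⌊t⌋₊, (1 : ℕ → ℂ) k) * (t : ℂ) ^ (-(s + 1))
      = 1 / (s - 1) - ∫ t in Ioi (1 : ℝ), ((Int.fract t : ℝ) : ℂ) * (t : ℂ) ^ (-(s + 1)) := by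
    have h1 : ∫ t in Ioi (1 : ℝ), (t : ℂ) ^ (-s) = 1 / (s - 1) := by
      rw [integral_Ioi_cpow_of_lt (by simpa using hs) one_pos]
      simp only [Complex.ofReal_one, Complex.one_cpow]
      rw [show -s + 1 = -(s - 1) by ring, div_neg, neg_div, neg_neg]
    rw [← h1, ← integral_sub hint1 hint2]
    refine setIntegral_congr_fun measurableSet_Ioi fun t ht => ?_
    have ht0 : (0 : ℝ) < t := zero_lt_one.trans ht
    have hfl : ((⌊t⌋₊ : ℝ)) = t - Int.fract t := by
      rw [natCast_floor_eq_intCast_floor ht0.le, Int.self_sub_fract]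
    have hc : (t : ℂ) ^ (-s) = t * (t : ℂ) ^ (-(s + 1)) := by
      rw [show -s = 1 + -(s + 1) by ring, Complex.cpow_add _ _ (by exact_mod_cast ht0.ne'),
        Complex.cpow_one]
    have hfl' : ((⌊t⌋₊ : ℂ)) = t - ((Int.fract t : ℝ) : ℂ) := by
      exact_mod_cast congrArg (Complex.ofReal) hfl
    simp only [Pi.one_apply, Finset.sum_const, Nat.card_Icc, add_tsub_cancel_right, nsmul_eq_mul,
      mul_one, hfl', hc]
    ring
  rw [hsplit, riemannZeta_eq_inv_sub_mul (sub_ne_zero.mp hs1)] at hL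
  rw [mellin_fract_eq]
  field_simp at hL
  linear_combination hL

open Set Filter in
theorem riemannZeta₁_eq {s : ℂ} (hs : 0 < s.re) :
    riemannZeta₁ s = s - s * (s - 1) *
      mellin (indicator (Ioi 1) fun t : ℝ => ((Int.fract t : ℝ) : ℂ)) (-s) := by
  have ho : IsOpen {s : ℂ | 0 < s.re} := isOpen_lt continuous_const Complex.continuous_re
  refine AnalyticOnNhd.eqOn_of_preconnected_of_eventuallyEq (U := {s : ℂ | 0 < s.re}) (z₀ := 2)
    (f := riemannZeta₁) (g := fun s => s - s * (s - 1) *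
      mellin (indicator (Ioi 1) fun t : ℝ => ((Int.fract t : ℝ) : ℂ)) (-s))
    (differentiable_riemannZeta₁.differentiableOn.analyticOnNhd ho)
    (DifferentiableOn.analyticOnNhd (fun s hs => ?_) ho)
    (convex_halfSpace_re_gt 0).isPreconnected (by simp) ?_ hs
  · have := (mellinConvergent_fract_and_differentiableAt s hs).2.comp s differentiableAt_id.neg
    refine DifferentiableAt.differentiableWithinAt ?_
    exact differentiableAt_id.sub ((differentiableAt_id.mul (differentiableAt_id.sub_const 1)).mul this)
  · filter_upwards [(isOpen_lt continuous_const Complex.continuous_re).mem_nhds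
      (show (2 : ℂ) ∈ {s : ℂ | 1 < s.re} by simp)] with s hs
    exact riemannZeta₁_eq_of_one_lt_re hs

theorem riemannZeta₁_ofReal_pos {σ : ℝ} (hσ : 0 < σ) : ∃ y : ℝ, 0 < y ∧ riemannZeta₁ σ = y := by
  rcases lt_or_ge 1 σ with h | h
  · refine ⟨(σ - 1) * (riemannZeta σ).re, mul_pos (by linarith) (riemannZeta_re_pos_of_one_lt h), ?_⟩
    have h1 : (σ : ℂ) ≠ 1 := by exact_mod_cast h.ne'
    have h2 : riemannZeta σ = ((riemannZeta σ).re : ℂ) := by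
      apply Complex.ext <;> simp [riemannZeta_im_eq_zero_of_one_lt h]
    push_cast
    rw [← h2, riemannZeta_eq_inv_sub_mul h1, mul_inv_cancel_left₀ (sub_ne_zero.mpr h1)]
  · refine ⟨σ + σ * (1 - σ) * ∫ t in Set.Ioi (1 : ℝ), Int.fract t * t ^ (-(σ + 1)), ?_, ?_⟩
    · have : 0 ≤ ∫ t in Set.Ioi (1 : ℝ), Int.fract t * t ^ (-(σ + 1)) :=
        setIntegral_nonneg measurableSet_Ioi fun t ht =>
          mul_nonneg (Int.fract_nonneg _) (Real.rpow_nonneg (zero_lt_one.trans ht).le _)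
      have h3 : 0 ≤ 1 - σ := by linarith
      positivity
    · rw [riemannZeta₁_eq (by simpa using hσ), mellin_fract_eq]
      have : ∫ t in Set.Ioi (1 : ℝ), ((Int.fract t : ℝ) : ℂ) * (t : ℂ) ^ (-((σ : ℂ) + 1)) =
          ((∫ t in Set.Ioi (1 : ℝ), Int.fract t * t ^ (-(σ + 1)) : ℝ) : ℂ) := by
        rw [← integral_complex_ofReal]
        refine setIntegral_congr_fun measurableSet_Ioi fun t ht => ?_
        simp only [Complex.ofReal_mul]
        rw [Complex.ofReal_cpow (zero_lt_one.trans ht).le]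
        push_cast; rfl
      rw [this]; push_cast; ring

theorem one_add_cpow_sub_isBigO_two (a : ℂ) :
    (fun v : ℂ => (1 + v) ^ a - (1 + a * v)) =O[nhds 0] fun v : ℂ => ‖v‖ ^ 2 := by
  have h := (Complex.one_add_cpow_hasFPowerSeriesAt_zero (a := a)).isBigO_sub_partialSum_pow 2
  refine h.congr_left fun v => ?_
  simp [FormalMultilinearSeries.partialSum, Finset.sum_range_succ, binomialSeries]
  ring

theorem one_add_cpow_sub_isBigO_three (a : ℂ) :
    (fun v : ℂ => (1 + v) ^ a - (1 + a * v + a * (a - 1) / 2 * v ^ 2)) =O[nhds 0]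
      fun v : ℂ => ‖v‖ ^ 3 := by
  have h := (Complex.one_add_cpow_hasFPowerSeriesAt_zero (a := a)).isBigO_sub_partialSum_pow 3
  refine h.congr_left fun v => ?_
  have h2 : Ring.choose a 2 = a * (a - 1) / 2 := by
    have := Ring.descPochhammer_eq_factorial_smul_choose a 2
    simp [descPochhammer_succ_right, Polynomial.smeval_mul,
      Polynomial.smeval_sub] at this
    rw [eq_div_iff two_ne_zero, this]; ring
  simp [FormalMultilinearSeries.partialSum, Finset.sum_range_succ, binomialSeries, h2]
  ring

theorem norm_le_one_of_fake {ε : ℕ → ℂ} (hε0 : ε 0 = 1)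
    (hε : ∀ k, 1 ≤ k → ‖ε k‖ = 1 ∨ ε k = 0) (k : ℕ) : ‖ε k‖ ≤ 1 := by
  rcases Nat.eq_zero_or_pos k with rfl | hk
  · simp [hε0]
  · rcases hε k hk with h | h <;> simp [h]

theorem tsum_sub_isBigO_three {ε : ℕ → ℂ} (hε : ∀ k, ‖ε k‖ ≤ 1) :
    (fun v : ℂ => ∑' k, ε k * v ^ k - (ε 0 + ε 1 * v + ε 2 * v ^ 2)) =O[nhds 0]
      fun v : ℂ => ‖v‖ ^ 3 := by
  refine Asymptotics.IsBigO.of_bound 2 ?_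
  filter_upwards [Metric.closedBall_mem_nhds (0 : ℂ) (show (0 : ℝ) < 1 / 2 by norm_num)] with v hv
  have hv : ‖v‖ ≤ 1 / 2 := by simpa using hv
  have hb : ∀ k, ‖ε k * v ^ k‖ ≤ ‖v‖ ^ k := fun k => by
    rw [norm_mul, norm_pow]
    exact mul_le_of_le_one_left (by positivity) (hε k)
  have hgeo : Summable fun k => ‖v‖ ^ k :=
    summable_geometric_of_lt_one (norm_nonneg _) (by linarith)
  have hs : Summable fun k => ε k * v ^ k := hgeo.of_norm_bounded hb
  rw [← hs.sum_add_tsum_nat_add 3]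
  simp only [Finset.sum_range_succ, Finset.sum_range_zero, pow_zero, pow_one, mul_one, zero_add,
    add_sub_cancel_left, norm_pow, norm_norm]
  have hgeo3 : HasSum (fun k => ‖v‖ ^ (k + 3)) ((1 - ‖v‖)⁻¹ * ‖v‖ ^ 3) := by
    simp only [pow_add]
    exact (hasSum_geometric_of_lt_one (norm_nonneg _) (by linarith)).mul_right _
  refine (tsum_of_norm_bounded hgeo3 fun k => hb _).trans ?_
  gcongr
  rw [inv_le_comm₀ (by linarith) two_pos]
  linarith

theorem Asymptotics.IsBigO.mul_sub_mul {f p g q : ℂ → ℂ} {r : ℂ → ℝ} {l : Filter ℂ}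
    (hf : (fun v => f v - p v) =O[l] r) (hg : (fun v => g v - q v) =O[l] r)
    (hf1 : f =O[l] fun _ => (1 : ℝ)) (hq1 : q =O[l] fun _ => (1 : ℝ)) :
    (fun v => f v * g v - p v * q v) =O[l] r := by
  have h1 := hf1.mul hg
  have h2 := hf.mul hq1
  simp only [one_mul, mul_one] at h1 h2
  exact (h1.add h2).congr_left fun v => by ring

theorem localFactor_sub_one_isBigO {ε : ℕ → ℂ} (hε0 : ε 0 = 1) (hε : ∀ k, ‖ε k‖ ≤ 1) :
    (fun v : ℂ => (1 - v) ^ ε 1 * (1 - v ^ 2) ^ (ε 2 - ε 1 * (ε 1 + 1) / 2) *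
      (∑' k, ε k * v ^ k) - 1) =O[nhds 0] fun v : ℂ => ‖v‖ ^ 3 := by
  set z := ε 1 with hz
  set w := ε 2 - z * (z + 1) / 2 with hw
  have hA : (fun v : ℂ => (1 - v) ^ z - (1 - z * v + z * (z - 1) / 2 * v ^ 2)) =O[nhds 0]
      fun v : ℂ => ‖v‖ ^ 3 := by
    have h := (one_add_cpow_sub_isBigO_three z).comp_tendsto
      (show Filter.Tendsto (fun v : ℂ => -v) (nhds 0) (nhds 0) by
        simpa using (continuous_neg (G := ℂ)).tendsto 0)
    refine (h.congr_left fun v => ?_).congr_right fun v => by simp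
    simp only [Function.comp]; ring_nf
  have hB : (fun v : ℂ => (1 - v ^ 2) ^ w - (1 - w * v ^ 2)) =O[nhds 0]
      fun v : ℂ => ‖v‖ ^ 3 := by
    have h := (one_add_cpow_sub_isBigO_two w).comp_tendsto
      (show Filter.Tendsto (fun v : ℂ => -v ^ 2) (nhds 0) (nhds 0) by
        exact (show Continuous fun v : ℂ => -v ^ 2 by fun_prop).tendsto' 0 0 (by simp))
    have h4 : (fun v : ℂ => ‖v‖ ^ 4) =O[nhds 0] fun v : ℂ => ‖v‖ ^ 3 := by
      refine Asymptotics.IsBigO.of_bound 1 ?_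
      filter_upwards [Metric.closedBall_mem_nhds (0 : ℂ) one_pos] with v hv
      have hv : ‖v‖ ≤ 1 := by simpa using hv
      simp only [norm_pow, norm_norm, one_mul]
      exact pow_le_pow_of_le_one (norm_nonneg _) hv (by norm_num)
    refine ((h.congr_left fun v => ?_).congr_right fun v => ?_).trans h4
    · simp only [Function.comp]; ring_nf
    · simp only [Function.comp, norm_neg, norm_pow]; ring
  have hC := tsum_sub_isBigO_three hε
  have one_of_cont : ∀ {f : ℂ → ℂ}, ContinuousAt f 0 → f =O[nhds 0] fun _ => (1 : ℝ) :=
    fun h => h.norm.isBoundedUnder_le.isBigO_one ℝ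
  have hcA : ContinuousAt (fun v : ℂ => (1 - v) ^ z) 0 :=
    ContinuousAt.cpow (by fun_prop) continuousAt_const (by simp)
  have hcB : ContinuousAt (fun v : ℂ => (1 - v ^ 2) ^ w) 0 :=
    ContinuousAt.cpow (by fun_prop) continuousAt_const (by simp)
  have hAB := hA.mul_sub_mul hB (one_of_cont hcA) (one_of_cont (by fun_prop))
  have hABC := hAB.mul_sub_mul hC (one_of_cont (hcA.mul hcB)) (one_of_cont (by fun_prop))
  have hrem : (fun v : ℂ => v ^ 3 * (ε 2 * (-z) + z * (z - 1) / 2 * z + z * w - w * z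
      + (ε 2 * (z * (z - 1) / 2) - w * ε 2 + w * z * z - w * (z * (z - 1) / 2)) * v
      + (w * z * ε 2 - z * (z - 1) / 2 * w * z) * v ^ 2 - z * (z - 1) / 2 * w * ε 2 * v ^ 3))
      =O[nhds 0] fun v : ℂ => ‖v‖ ^ 3 := by
    have h1 : (fun v : ℂ => v ^ 3) =O[nhds 0] fun v : ℂ => ‖v‖ ^ 3 :=
      Asymptotics.IsBigO.of_bound 1 (Filter.Eventually.of_forall fun v => by simp)
    have := h1.mul (one_of_cont (f := fun v : ℂ =>
      (ε 2 * (-z) + z * (z - 1) / 2 * z + z * w - w * z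
      + (ε 2 * (z * (z - 1) / 2) - w * ε 2 + w * z * z - w * (z * (z - 1) / 2)) * v
      + (w * z * ε 2 - z * (z - 1) / 2 * w * z) * v ^ 2 - z * (z - 1) / 2 * w * ε 2 * v ^ 3))
      (by fun_prop))
    simpa only [mul_one] using this
  refine (hABC.add hrem).congr_left fun v => ?_
  have : w = ε 2 - z * (z + 1) / 2 := hw
  clear_value w
  subst this
  rw [hε0, ← hz]
  ring

theorem localFactor_continuousOn {ε : ℕ → ℂ} (hε : ∀ k, ‖ε k‖ ≤ 1) (z w : ℂ) {r : ℝ}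
    (hr0 : 0 ≤ r) (hr : r < 1) :
    ContinuousOn (fun v : ℂ => (1 - v) ^ z * (1 - v ^ 2) ^ w * (∑' k, ε k * v ^ k))
      (Metric.closedBall 0 r) := by
  have hslit : ∀ v : ℂ, ‖v‖ < 1 → 1 - v ∈ Complex.slitPlane := fun v hv => by
    simpa [sub_eq_add_neg] using Complex.mem_slitPlane_of_norm_lt_one (z := -v) (by simpa using hv)
  have hnorm : ∀ v ∈ Metric.closedBall (0 : ℂ) r, ‖v‖ ≤ r := fun v hv => by simpa using hv
  refine ((ContinuousOn.cpow (by fun_prop) continuousOn_const fun v hv => ?_).mul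
    (ContinuousOn.cpow (by fun_prop) continuousOn_const fun v hv => ?_)).mul
    (continuousOn_tsum (u := fun k => r ^ k) (fun k => by fun_prop)
      (summable_geometric_of_lt_one hr0 hr) fun k v hv => ?_)
  · exact hslit _ ((hnorm v hv).trans_lt hr)
  · refine hslit _ ?_
    rw [norm_pow]
    exact pow_lt_one₀ (norm_nonneg _) ((hnorm v hv).trans_lt hr) two_ne_zero
  · rw [norm_mul, norm_pow]
    exact (mul_le_of_le_one_left (by positivity) (hε k)).trans
      (pow_le_pow_left₀ (norm_nonneg _) (hnorm v hv) k)

theorem eulerProduct_continuousOn {ε : ℕ → ℂ} (hε0 : ε 0 = 1) (hε : ∀ k, ‖ε k‖ ≤ 1) :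
    ContinuousOn (fun u : ℝ => ∏' p : Nat.Primes,
      (1 - ((p : ℕ) : ℂ) ^ (-(1 - (u : ℂ)))) ^ ε 1 *
        (1 - ((p : ℕ) : ℂ) ^ (-(2 * (1 - (u : ℂ))))) ^ (ε 2 - ε 1 * (ε 1 + 1) / 2) *
        (∑' k : ℕ, ε k * (((p : ℕ) : ℂ) ^ (-(1 - (u : ℂ)))) ^ k)) (Set.Icc 0 (1 / 2)) := by
  set F : ℂ → ℂ := fun v => (1 - v) ^ ε 1 * (1 - v ^ 2) ^ (ε 2 - ε 1 * (ε 1 + 1) / 2) *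
      (∑' k, ε k * v ^ k) with hF
  have hfac : ∀ (p : Nat.Primes) (u : ℝ), (1 - ((p : ℕ) : ℂ) ^ (-(1 - (u : ℂ)))) ^ ε 1 *
        (1 - ((p : ℕ) : ℂ) ^ (-(2 * (1 - (u : ℂ))))) ^ (ε 2 - ε 1 * (ε 1 + 1) / 2) *
        (∑' k : ℕ, ε k * (((p : ℕ) : ℂ) ^ (-(1 - (u : ℂ)))) ^ k) =
        1 + (F (((p : ℕ) : ℂ) ^ (-(1 - (u : ℂ)))) - 1) := fun p u => by
    rw [add_sub_cancel, hF]
    simp only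
    rw [← Complex.cpow_nat_mul]
    congr 5
    push_cast; ring
  simp only [hfac]
  have hnorm : ∀ (p : Nat.Primes), ∀ u ∈ Set.Icc (0 : ℝ) (1 / 2),
      ‖((p : ℕ) : ℂ) ^ (-(1 - (u : ℂ)))‖ ≤ ((p : ℕ) : ℝ) ^ (-(1 / 2) : ℝ) := fun p u hu => by
    rw [Complex.norm_natCast_cpow_of_pos p.2.pos]
    refine Real.rpow_le_rpow_of_exponent_le (by exact_mod_cast p.2.one_le) ?_
    simp
    linarith [hu.2]
  have hcube : ∀ p : Nat.Primes,
      (((p : ℕ) : ℝ) ^ (-(1 / 2) : ℝ)) ^ 3 = ((p : ℕ) : ℝ) ^ (-(3 / 2) : ℝ) := fun p => by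
    rw [← Real.rpow_natCast, ← Real.rpow_mul (Nat.cast_nonneg _)]
    norm_num
  have hsum : Summable fun p : Nat.Primes => ((p : ℕ) : ℝ) ^ (-(3 / 2) : ℝ) :=
    Nat.Primes.summable_rpow.mpr (by norm_num)
  obtain ⟨C, hC⟩ := (localFactor_sub_one_isBigO hε0 hε).bound
  obtain ⟨δ, hδ, hball⟩ := Metric.eventually_nhds_iff.mp hC
  have hC0 : ∀ {v : ℂ}, ‖v‖ < δ → ‖F v - 1‖ ≤ |C| * ‖v‖ ^ 3 := fun {v} hv => by
    have := hball (y := v) (by simpa using hv)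
    simp only [norm_pow, norm_norm] at this
    exact this.trans (by gcongr; exact le_abs_self C)
  have hcont : ∀ p : Nat.Primes, ContinuousOn
      (fun u : ℝ => F (((p : ℕ) : ℂ) ^ (-(1 - (u : ℂ)))) - 1) (Set.Icc 0 (1 / 2)) := fun p => by
    have hp0 : ((p : ℕ) : ℂ) ≠ 0 := by exact_mod_cast p.2.ne_zero
    have hmaps : Set.MapsTo (fun u : ℝ => ((p : ℕ) : ℂ) ^ (-(1 - (u : ℂ)))) (Set.Icc 0 (1 / 2))
        (Metric.closedBall 0 ((2 : ℝ) ^ (-(1 / 2) : ℝ))) := fun u hu => by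
      rw [mem_closedBall_zero_iff]
      refine (hnorm p u hu).trans ?_
      exact Real.rpow_le_rpow_of_nonpos two_pos (by exact_mod_cast p.2.two_le) (by norm_num)
    refine ContinuousOn.sub ?_ continuousOn_const
    refine (localFactor_continuousOn hε _ _ (by positivity)
      (Real.rpow_lt_one_of_one_lt_of_neg one_lt_two (by norm_num))).comp ?_ hmaps
    refine Continuous.continuousOn ?_
    exact Continuous.const_cpow (by fun_prop) (Or.inl hp0)
  have hprod := Summable.hasProdUniformlyOn_one_add (ι := Nat.Primes)
    (f := fun p (u : ℝ) => F (((p : ℕ) : ℂ) ^ (-(1 - (u : ℂ)))) - 1)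
    (isCompact_Icc (a := (0 : ℝ)) (b := 1 / 2))
    (hsum.mul_left |C|) ?_ ?_
  · refine hprod.tendstoUniformlyOn.continuousOn (Filter.Eventually.frequently ?_)
    refine Filter.Eventually.of_forall fun s => ?_
    exact continuousOn_finsetProd _ fun p _ => continuousOn_const.add (hcont p)
  · have := hsum.tendsto_cofinite_zero.eventually (gt_mem_nhds (pow_pos hδ 3))
    filter_upwards [this] with p hp u hu
    rw [← hcube] at hp ⊢
    have hlt := lt_of_pow_lt_pow_left₀ 3 hδ.le hp
    refine (hC0 ((hnorm p u hu).trans_lt hlt)).trans ?_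
    gcongr
    exact hnorm p u hu
  · exact hcont

open Filter Topology in
theorem laplace_tendsto_of_bounded {z a : ℂ} (hz : z.re < 1) {δ M : ℝ} (hδ : 0 < δ) {f : ℝ → ℂ}
    (hc : ContinuousOn f (Set.Ioo 0 δ)) (hM : ∀ u ∈ Set.Ioo 0 δ, ‖f u‖ ≤ M)
    (hf : Tendsto f (𝓝[>] 0) (𝓝 a)) :
    Tendsto (fun L : ℝ => (∫ u in Set.Ioo (0 : ℝ) δ,
      Complex.exp (-((u * L : ℝ) : ℂ)) * (u : ℂ) ^ (-z) * f u) * (L : ℂ) ^ (1 - z))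
      atTop (𝓝 (Complex.Gamma (1 - z) * a)) := by
  have hσ : 0 < (1 - z).re := by simpa using hz
  have hGam : Complex.Gamma (1 - z) * a =
      ∫ t in Set.Ioi (0 : ℝ), ((Real.exp (-t) : ℝ) : ℂ) * (t : ℂ) ^ (-z) * a := by
    rw [integral_mul_const, Complex.Gamma_eq_integral hσ, Complex.GammaIntegral]
    simp
  have hsub : ∀ L : ℝ, 0 < L → (∫ u in Set.Ioo (0 : ℝ) δ,
      Complex.exp (-((u * L : ℝ) : ℂ)) * (u : ℂ) ^ (-z) * f u) * (L : ℂ) ^ (1 - z) =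
      ∫ t in Set.Ioi (0 : ℝ), Set.indicator (Set.Ioo 0 (δ * L))
        (fun t : ℝ => ((Real.exp (-t) : ℝ) : ℂ) * (t : ℂ) ^ (-z) * f (t / L)) t := fun L hL => by
    have hLc : (L : ℂ) ≠ 0 := by exact_mod_cast hL.ne'
    have h := integral_comp_mul_left_Ioi (Set.indicator (Set.Ioo 0 (δ * L))
        (fun t : ℝ => ((Real.exp (-t) : ℝ) : ℂ) * (t : ℂ) ^ (-z) * f (t / L))) 0 hL
    rw [mul_zero, eq_inv_smul_iff₀ hL.ne'] at h
    rw [← h, ← integral_indicator measurableSet_Ioo, ← integral_indicator measurableSet_Ioi,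
      ← integral_mul_const, ← integral_smul]
    congr 1
    ext u
    by_cases hu : u ∈ Set.Ioo 0 δ
    · have hu' : L * u ∈ Set.Ioo 0 (δ * L) :=
        ⟨mul_pos hL hu.1, by rw [mul_comm]; exact mul_lt_mul_of_pos_right hu.2 hL⟩
      rw [Set.indicator_of_mem hu, Set.indicator_of_mem (show u ∈ Set.Ioi 0 from hu.1),
        Set.indicator_of_mem hu', mul_div_cancel_left₀ _ hL.ne', Complex.ofReal_mul L,
        Complex.mul_cpow_ofReal_nonneg hL.le hu.1.le, sub_eq_add_neg, Complex.cpow_add _ _ hLc,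
        Complex.cpow_one, Complex.real_smul]
      push_cast
      ring_nf
    · rw [Set.indicator_of_notMem hu, zero_mul]
      symm
      by_cases hu0 : u ∈ Set.Ioi (0 : ℝ)
      · rw [Set.indicator_of_mem hu0, Set.indicator_of_notMem, smul_zero]
        intro h'
        refine hu ⟨hu0, ?_⟩
        have := h'.2
        rw [mul_comm] at this
        exact lt_of_mul_lt_mul_right this hL.le
      · rw [Set.indicator_of_notMem hu0, smul_zero]
  rw [hGam]
  refine Tendsto.congr' ((eventually_gt_atTop 0).mono fun L hL => (hsub L hL).symm) ?_
  refine tendsto_integral_filter_of_dominated_convergence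
    (fun t => M * (Real.exp (-t) * t ^ ((1 - z).re - 1))) ?_ ?_ ?_ ?_
  · filter_upwards [eventually_gt_atTop 0] with L hL
    refine AEStronglyMeasurable.restrict ?_
    refine (aestronglyMeasurable_indicator_iff measurableSet_Ioo).mpr
      (ContinuousOn.aestronglyMeasurable ?_ measurableSet_Ioo)
    refine (ContinuousOn.mul (by fun_prop) fun t ht => ?_).mul
      (hc.comp (by fun_prop) fun t ht => ⟨div_pos ht.1 hL, by rw [div_lt_iff₀ hL]; exact ht.2⟩)
    exact (Complex.continuousAt_ofReal_cpow_const t _ (Or.inr ht.1.ne')).continuousWithinAt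
  · filter_upwards [eventually_gt_atTop 0] with L hL
    refine (ae_restrict_iff' measurableSet_Ioi).mpr (Eventually.of_forall fun t ht => ?_)
    have ht : 0 < t := ht
    have hM0 : 0 ≤ M := (norm_nonneg _).trans (hM (δ / 2) ⟨by positivity, by linarith⟩)
    by_cases h : t ∈ Set.Ioo 0 (δ * L)
    · rw [Set.indicator_of_mem h, norm_mul, norm_mul, Complex.norm_real,
        Complex.norm_cpow_eq_rpow_re_of_pos ht, Real.norm_of_nonneg (Real.exp_pos _).le, mul_comm M]
      have := hM (t / L) ⟨by positivity, by rw [div_lt_iff₀ hL]; exact h.2⟩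
      simp only [Complex.sub_re, Complex.one_re, Complex.neg_re, sub_sub_cancel_left]
      gcongr
    · rw [Set.indicator_of_notMem h, norm_zero]
      positivity
  · exact (Real.GammaIntegral_convergent hσ).const_mul M
  · refine (ae_restrict_iff' measurableSet_Ioi).mpr (Eventually.of_forall fun t ht => ?_)
    have ht : 0 < t := ht
    have hlim : Tendsto (fun L : ℝ => t / L) atTop (𝓝[>] 0) := by
      refine tendsto_nhdsWithin_iff.mpr ⟨tendsto_const_nhds.div_atTop tendsto_id, ?_⟩
      filter_upwards [eventually_gt_atTop 0] with L hL using div_pos ht hL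
    refine Tendsto.congr' ?_ ((hf.comp hlim).const_mul (((Real.exp (-t) : ℝ) : ℂ) * (t : ℂ) ^ (-z)))
    filter_upwards [eventually_gt_atTop (t / δ)] with L hL
    rw [Set.indicator_of_mem (show t ∈ Set.Ioo 0 (δ * L) from
      ⟨ht, by rwa [div_lt_iff₀' hδ] at hL⟩)]
    rfl

open Filter Topology in
theorem laplace_tendsto {z a : ℂ} (hz : z.re < 1) {b : ℝ} (hb : 0 < b) {f : ℝ → ℂ}
    (hc : ContinuousOn f (Set.Ioo 0 b))
    (hint : IntegrableOn (fun u : ℝ => (u : ℂ) ^ (-z) * f u) (Set.Ioo 0 b))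
    (hf : Tendsto f (𝓝[>] 0) (𝓝 a)) :
    Tendsto (fun L : ℝ => (∫ u in Set.Ioo (0 : ℝ) b,
      Complex.exp (-((u * L : ℝ) : ℂ)) * (u : ℂ) ^ (-z) * f u) * (L : ℂ) ^ (1 - z))
      atTop (𝓝 (Complex.Gamma (1 - z) * a)) := by
  obtain ⟨M, hM⟩ := hf.norm.isBoundedUnder_le
  obtain ⟨δ₀, hδ₀, hball⟩ := mem_nhdsGT_iff_exists_Ioo_subset.mp (Filter.eventually_map.mp hM)
  have hδ₀ : 0 < δ₀ := hδ₀
  obtain ⟨δ, hδ, hδlt⟩ := exists_between (lt_min hδ₀ hb)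
  have hδb : δ < b := hδlt.trans_le (min_le_right _ _)
  have hmain := laplace_tendsto_of_bounded hz hδ (M := M)
    (hc.mono (Set.Ioo_subset_Ioo_right hδb.le))
    (fun u hu => hball ⟨hu.1, hu.2.trans (hδlt.trans_le (min_le_left _ _))⟩) hf
  have hexp : ∀ L u : ℝ, ‖Complex.exp (-((u * L : ℝ) : ℂ))‖ = Real.exp (-(u * L)) := fun L u => by
    rw [← Complex.ofReal_neg, Complex.norm_exp_ofReal]
  have hintL : ∀ L : ℝ, 0 ≤ L → IntegrableOn (fun u : ℝ =>
      Complex.exp (-((u * L : ℝ) : ℂ)) * (u : ℂ) ^ (-z) * f u) (Set.Ioo 0 b) := fun L hL => by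
    refine Integrable.mono hint ?_ ?_
    · simp only [mul_assoc]
      exact (Continuous.aestronglyMeasurable (by fun_prop)).mul hint.1
    · refine (ae_restrict_iff' measurableSet_Ioo).mpr (Eventually.of_forall fun u hu => ?_)
      rw [mul_assoc, norm_mul, hexp]
      refine mul_le_of_le_one_left (norm_nonneg _) (Real.exp_le_one_iff.mpr ?_)
      have := mul_nonneg hu.1.le hL
      linarith
  have htail : Tendsto (fun L : ℝ => (∫ u in Set.Ico δ b,
      Complex.exp (-((u * L : ℝ) : ℂ)) * (u : ℂ) ^ (-z) * f u) * (L : ℂ) ^ (1 - z))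
      atTop (𝓝 0) := by
    have hint' := hint.mono_set (show Set.Ico δ b ⊆ Set.Ioo 0 b from
      fun u hu => ⟨hδ.trans_le hu.1, hu.2⟩)
    have h0 := (tendsto_rpow_mul_exp_neg_mul_atTop_nhds_zero (1 - z).re δ hδ).mul_const
      (∫ u in Set.Ico δ b, ‖(u : ℂ) ^ (-z) * f u‖)
    rw [zero_mul] at h0
    refine squeeze_zero_norm' ?_ h0
    filter_upwards [eventually_gt_atTop 0] with L hL
    have hle : ‖∫ u in Set.Ico δ b, Complex.exp (-((u * L : ℝ) : ℂ)) * (u : ℂ) ^ (-z) * f u‖ ≤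
        Real.exp (-δ * L) * ∫ u in Set.Ico δ b, ‖(u : ℂ) ^ (-z) * f u‖ := by
      rw [← integral_const_mul]
      refine norm_integral_le_of_norm_le (hint'.norm.const_mul _) ?_
      refine (ae_restrict_iff' measurableSet_Ico).mpr (Eventually.of_forall fun u hu => ?_)
      rw [mul_assoc, norm_mul, hexp]
      gcongr
      have := mul_le_mul_of_nonneg_right hu.1 hL.le
      linarith
    rw [norm_mul, Complex.norm_cpow_eq_rpow_re_of_pos hL, mul_comm, mul_assoc]
    gcongr
  have hadd := hmain.add htail
  rw [add_zero] at hadd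
  refine hadd.congr' ((eventually_gt_atTop 0).mono fun L hL => ?_)
  beta_reduce
  rw [← add_mul, ← Set.Ioo_union_Ico_eq_Ioo hδ hδb.le, setIntegral_union ?_ measurableSet_Ico]
  · exact (hintL L hL.le).mono_set (Set.Ioo_subset_Ioo_right hδb.le)
  · exact (hintL L hL.le).mono_set fun u hu => ⟨hδ.trans_le hu.1, hu.2⟩
  · exact Set.disjoint_left.mpr fun u hu hu' => absurd hu.2 hu'.1.not_gt

theorem intervalIntegrable_cpow_mul_cpow {z w : ℂ} (hz : z.re < 1) (hw : w.re < 1) :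
    IntervalIntegrable (fun u : ℝ => (u : ℂ) ^ (-z) * (1 - 2 * (u : ℂ)) ^ (-w)) volume 0 (1 / 2) := by
  have h := (Complex.betaIntegral_convergent (u := 1 - z) (v := 1 - w)
    (by simpa using hz) (by simpa using hw)).comp_mul_left (c := 2)
  simp only [zero_div] at h
  refine (h.const_mul ((2 : ℂ) ^ z)).congr fun u hu => ?_
  rw [Set.uIoc_of_le (by norm_num)] at hu
  simp only [Complex.ofReal_mul, sub_sub_cancel_left]
  rw [Complex.mul_cpow_ofReal_nonneg two_pos.le hu.1.le, ← mul_assoc, ← mul_assoc]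
  push_cast
  rw [← Complex.cpow_add _ _ two_ne_zero, add_neg_cancel, Complex.cpow_zero, one_mul]

theorem neg_mul_riemannZeta_one_sub {u : ℝ} (hu : u ∈ Set.Ioo (0 : ℝ) (1 / 2)) :
    (-(u : ℂ)) * riemannZeta (1 - (u : ℂ)) = riemannZeta₁ ((1 - u : ℝ) : ℂ) := by
  have h0 : (u : ℂ) ≠ 0 := by exact_mod_cast hu.1.ne'
  have h1 : 1 - (u : ℂ) ≠ 1 := by simpa using h0
  rw [riemannZeta_eq_inv_sub_mul h1]
  push_cast
  rw [sub_sub_cancel_left, mul_inv_cancel_left₀ (neg_ne_zero.mpr h0)]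

theorem riemannZeta_two_sub {u : ℝ} (hu : u ∈ Set.Ioo (0 : ℝ) (1 / 2)) :
    riemannZeta (2 - 2 * (u : ℂ)) =
      (((1 - 2 * u)⁻¹ : ℝ) : ℂ) * riemannZeta₁ ((2 - 2 * u : ℝ) : ℂ) := by
  have h1 : 2 - 2 * (u : ℂ) ≠ 1 := by
    have : 2 - 2 * u ≠ 1 := by linarith [hu.2]
    exact_mod_cast this
  rw [riemannZeta_eq_inv_sub_mul h1]
  push_cast
  congr 2
  ring

theorem continuous_riemannZeta₁_cpow {g : ℝ → ℝ} (hg : Continuous g) {s : Set ℝ}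
    (hpos : ∀ u ∈ s, 0 < g u) (a : ℂ) :
    ContinuousOn (fun u => riemannZeta₁ (g u : ℂ) ^ a) s := by
  refine ContinuousOn.cpow (Continuous.continuousOn ?_) continuousOn_const fun u hu => ?_
  · exact differentiable_riemannZeta₁.continuous.comp (Complex.continuous_ofReal.comp hg)
  · obtain ⟨y, hy, h⟩ := riemannZeta₁_ofReal_pos (hpos u hu)
    rw [h]
    exact Complex.ofReal_mem_slitPlane.mpr hy

/-- For `−1 < Re z < 1`, `Re w < 1`: on `0 < u < 1/2` one has
`ζ(1−u) < 0` (so `(−u)ζ(1−u) > 0`) and `ζ(2−2u) > 0`; the Laplace integral defining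
`Δ₁(x)` converges absolutely for `x > 3`; and
`Δ₁(x) x^{−1} (log x)^{1−z} → (sin(πz)/π) Γ(1−z) ζ(2)^w G_𝔣(1)` as `x → ∞`. -/
theorem delta_one_asymptotics
    (ε : ℕ → ℂ) (hε0 : ε 0 = 1)
    (hε : ∀ k, 1 ≤ k → ‖ε k‖ = 1 ∨ ε k = 0)
    (z w : ℂ) (hz : z = ε 1) (hw : w = ε 2 - ε 1 * (ε 1 + 1) / 2)
    (hz1 : -1 < z.re) (hz2 : z.re < 1) (hw1 : w.re < 1)
    (G : ℂ → ℂ)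
    (hG : ∀ s : ℂ, G s = ∏' p : Nat.Primes,
      (1 - ((p : ℕ) : ℂ) ^ (-s)) ^ z * (1 - ((p : ℕ) : ℂ) ^ (-(2 * s))) ^ w *
        (∑' k : ℕ, ε k * (((p : ℕ) : ℂ) ^ (-s)) ^ k))
    (J₁ : ℝ → ℂ)
    (hJ₁ : ∀ u : ℝ, J₁ u =
      ((-(u : ℂ)) * riemannZeta (1 - (u : ℂ))) ^ z *
        (riemannZeta (2 - 2 * (u : ℂ))) ^ w * G (1 - (u : ℂ)) *
        Complex.Gamma (1 - (u : ℂ)))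
    (Δ₁ : ℝ → ℂ)
    (hΔ₁ : ∀ x : ℝ, Δ₁ x =
      (Complex.sin ((Real.pi : ℂ) * z) / (Real.pi : ℂ)) * (x : ℂ) *
        ∫ u in Set.Ioo (0 : ℝ) (1 / 2),
          Complex.exp (-((u * Real.log x : ℝ) : ℂ)) * ((u : ℂ) ^ (-z)) * J₁ u) :
    (∀ u ∈ Set.Ioo (0 : ℝ) (1 / 2),
      (∃ y : ℝ, y < 0 ∧ riemannZeta (1 - (u : ℂ)) = (y : ℂ)) ∧
      (∃ y : ℝ, 0 < y ∧ (-(u : ℂ)) * riemannZeta (1 - (u : ℂ)) = (y : ℂ)) ∧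
      (∃ y : ℝ, 0 < y ∧ riemannZeta (2 - 2 * (u : ℂ)) = (y : ℂ))) ∧
    (∀ x : ℝ, 3 < x → IntegrableOn
      (fun u : ℝ => Complex.exp (-((u * Real.log x : ℝ) : ℂ)) * ((u : ℂ) ^ (-z)) * J₁ u)
      (Set.Ioo (0 : ℝ) (1 / 2))) ∧
    Filter.Tendsto
      (fun x : ℝ => Δ₁ x / (x : ℂ) * ((Real.log x : ℂ)) ^ ((1 : ℂ) - z))
      Filter.atTop
      (nhds ((Complex.sin ((Real.pi : ℂ) * z) / (Real.pi : ℂ)) *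
        Complex.Gamma (1 - z) * (riemannZeta 2) ^ w * G 1)) := by
  have hε1 := norm_le_one_of_fake hε0 hε
  have hGc : ContinuousOn (fun u : ℝ => G (1 - (u : ℂ))) (Set.Icc 0 (1 / 2)) := by
    refine (eulerProduct_continuousOn hε0 hε1).congr fun u _ => ?_
    rw [hG, hw, hz]
  set K : ℝ → ℂ := fun u => riemannZeta₁ ((1 - u : ℝ) : ℂ) ^ z *
    riemannZeta₁ ((2 - 2 * u : ℝ) : ℂ) ^ w * G (1 - (u : ℂ)) * Complex.Gamma (1 - (u : ℂ)) with hK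
  have hKc : ContinuousOn K (Set.Icc 0 (1 / 2)) := by
    refine (((continuous_riemannZeta₁_cpow (by fun_prop) (fun u hu => ?_) z).mul
      (continuous_riemannZeta₁_cpow (by fun_prop) (fun u hu => ?_) w)).mul hGc).mul fun u hu => ?_
    · linarith [hu.2]
    · linarith [hu.2]
    · refine ContinuousAt.continuousWithinAt ?_
      refine ContinuousAt.comp' (f := fun u : ℝ => 1 - (u : ℂ)) (g := Complex.Gamma)
        (Complex.differentiableAt_Gamma _ fun m h => ?_).continuousAt (by fun_prop)
      have := congrArg Complex.re h
      simp at this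
      linarith [hu.2, (Nat.cast_nonneg m : (0 : ℝ) ≤ m)]
  have hJK : ∀ u ∈ Set.Ioo (0 : ℝ) (1 / 2), J₁ u = (1 - 2 * (u : ℂ)) ^ (-w) * K u := by
    intro u hu
    have hpos : 0 < 1 - 2 * u := by linarith [hu.2]
    obtain ⟨y, hy, h⟩ := riemannZeta₁_ofReal_pos (show 0 < 2 - 2 * u by linarith)
    have hinv : (((1 - 2 * u)⁻¹ : ℝ) : ℂ) ^ w = (1 - 2 * (u : ℂ)) ^ (-w) := by
      rw [Complex.ofReal_inv, Complex.inv_cpow, Complex.cpow_neg]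
      · push_cast; rfl
      · rw [Complex.arg_ofReal_of_nonneg hpos.le]
        exact Real.pi_pos.ne
    rw [hJ₁, hK, neg_mul_riemannZeta_one_sub hu, riemannZeta_two_sub hu, h,
      Complex.mul_cpow_ofReal_nonneg (inv_pos.mpr hpos).le hy.le, hinv, ← h]
    ring
  have hint : ∀ L : ℝ, IntegrableOn
      (fun u : ℝ => Complex.exp (-((u * L : ℝ) : ℂ)) * ((u : ℂ) ^ (-z)) * J₁ u)
      (Set.Ioo (0 : ℝ) (1 / 2)) := by
    intro L
    have h := (intervalIntegrable_cpow_mul_cpow hz2 hw1).mul_continuousOn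
      (g := fun u => Complex.exp (-((u * L : ℝ) : ℂ)) * K u)
      (by
        rw [Set.uIcc_of_le (by norm_num)]
        exact (Continuous.continuousOn (by fun_prop)).mul hKc)
    rw [intervalIntegrable_iff_integrableOn_Ioo_of_le (by norm_num)] at h
    refine h.congr_fun (fun u hu => ?_) measurableSet_Ioo
    simp only [hJK u hu]
    ring
  refine ⟨fun u hu => ?_, fun x _ => hint _, ?_⟩
  · obtain ⟨y, hy, h⟩ := riemannZeta₁_ofReal_pos (show 0 < 1 - u by linarith [hu.2])
    obtain ⟨y', hy', h'⟩ := riemannZeta₁_ofReal_pos (show 0 < 2 - 2 * u by linarith [hu.2])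
    have hu0 : (u : ℂ) ≠ 0 := by exact_mod_cast hu.1.ne'
    have hneg := neg_mul_riemannZeta_one_sub hu
    rw [h] at hneg
    refine ⟨⟨-(y / u), neg_neg_of_pos (div_pos hy hu.1), ?_⟩, ⟨y, hy, hneg⟩,
      ⟨(1 - 2 * u)⁻¹ * y', mul_pos (inv_pos.mpr (by linarith [hu.2])) hy', ?_⟩⟩
    · push_cast
      rw [← hneg]
      field_simp
    · rw [riemannZeta_two_sub hu, h']
      push_cast; rfl
  · have hlim : Filter.Tendsto J₁ (nhdsWithin 0 (Set.Ioi 0)) (nhds (riemannZeta 2 ^ w * G 1)) := by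
      have hK0 : K 0 = riemannZeta 2 ^ w * G 1 := by
        have h2 : riemannZeta₁ 2 = riemannZeta 2 := by
          rw [riemannZeta_eq_inv_sub_mul (by norm_num : (2 : ℂ) ≠ 1)]
          norm_num
        simp [hK, h2]
      have hKlim : Filter.Tendsto K (nhdsWithin 0 (Set.Ioi 0)) (nhds (K 0)) := by
        refine ((hKc 0 (by norm_num)).mono_left ?_)
        rw [← nhdsWithin_Ioo_eq_nhdsGT (show (0 : ℝ) < 1 / 2 by norm_num)]
        exact nhdsWithin_mono _ Set.Ioo_subset_Icc_self
      have hone : Filter.Tendsto (fun u : ℝ => (1 - 2 * (u : ℂ)) ^ (-w))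
          (nhdsWithin 0 (Set.Ioi 0)) (nhds 1) := by
        have hc : ContinuousAt (fun u : ℝ => (1 - 2 * (u : ℂ)) ^ (-w)) 0 :=
          ContinuousAt.cpow (by fun_prop) continuousAt_const (by simp)
        have := hc.tendsto.mono_left (nhdsWithin_le_nhds (s := Set.Ioi (0 : ℝ)))
        simpa using this
      have := hone.mul hKlim
      rw [one_mul, hK0] at this
      refine this.congr' ?_
      filter_upwards [Ioo_mem_nhdsGT (show (0 : ℝ) < 1 / 2 by norm_num)] with u hu
        using (hJK u hu).symm
    have hJc : ContinuousOn J₁ (Set.Ioo 0 (1 / 2)) := by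
      refine ContinuousOn.congr (ContinuousOn.mul (fun u hu => ?_)
        (hKc.mono Set.Ioo_subset_Icc_self)) hJK
      refine ContinuousAt.continuousWithinAt
        (ContinuousAt.cpow (by fun_prop) continuousAt_const ?_)
      have : (0 : ℝ) < 1 - 2 * u := by linarith [hu.2]
      exact_mod_cast Complex.ofReal_mem_slitPlane.mpr this
    have hlap := (laplace_tendsto hz2 one_half_pos hJc (by simpa using hint 0) hlim).comp
      Real.tendsto_log_atTop
    refine Filter.Tendsto.congr' ?_ ((hlap.const_mul
      (Complex.sin ((Real.pi : ℂ) * z) / (Real.pi : ℂ))).trans_eq ?_)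
    · filter_upwards [Filter.eventually_gt_atTop 0] with x hx
      have hx0 : (x : ℂ) ≠ 0 := by exact_mod_cast hx.ne'
      rw [hΔ₁, Function.comp_apply]
      generalize (∫ u in Set.Ioo (0 : ℝ) (1 / 2),
        Complex.exp (-((u * Real.log x : ℝ) : ℂ)) * ((u : ℂ) ^ (-z)) * J₁ u) = I
      field_simp
    · congr 1
      ring
end
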